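/- arXiv:2108.01611 — 4 statements merged into one kernel-verified Lean document; each statement's English description precedes it below -/
import Mathlib

section
/- Let K = (K_n)_{n≥1} be a matrix convex set in V. If v lies in the interior of K₁ ⊆ V, then for every n ≥ 1 the diagonal matrix v ⊕ ⋯ ⊕ v ∈ M_n(V) (n copies of v on the diagonal, zeros elsewhere) lies in the interior of K_n ⊆ M_n(V). -/
open scoped Matrix Kronecker ComplexOrder

noncomputable section

variable {V : Type*} [AddCommGroup V] [Module ℂ V]

/-- The matrix `γ* A γ` computed entrywise via the `ℂ`-action on `V`. -/
def mconj {m n : ℕ} (γ : Matrix (Fin m) (Fin n) ℂ)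
    (A : Matrix (Fin m) (Fin m) V) : Matrix (Fin n) (Fin n) V :=
  Matrix.of fun i j => ∑ k, ∑ l, (star (γ k i) * γ l j) • A k l

/-- A graded family `K = (K_n)` is a matrix convex set. -/
def IsMatrixConvex (K : ∀ n : ℕ, Set (Matrix (Fin n) (Fin n) V)) : Prop :=
  ∀ (k n : ℕ), 0 < k → 0 < n →
    ∀ (ns : Fin k → ℕ) (A : ∀ i : Fin k, Matrix (Fin (ns i)) (Fin (ns i)) V)
      (γ : ∀ i : Fin k, Matrix (Fin (ns i)) (Fin n) ℂ),
      (∀ i, 0 < ns i) → (∀ i, A i ∈ K (ns i)) →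
      (∑ i, (γ i)ᴴ * γ i) = 1 →
      (∑ i, mconj (γ i) (A i)) ∈ K n

/-- The `r`-th ampliation of `Φ : V → M_m(ℂ)` applied to `B ∈ M_r(V)`, as a matrix
indexed by `Fin m × Fin r` (block `(i,j)`, inner indices `(p,q)` ↦ `Φ (B i j) p q`). -/
def amplify {m r : ℕ} (Φ : V → Matrix (Fin m) (Fin m) ℂ)
    (B : Matrix (Fin r) (Fin r) V) : Matrix (Fin m × Fin r) (Fin m × Fin r) ℂ :=
  Matrix.of fun p q => Φ (B p.2 q.2) p.1 q.1

/-- Hermitian part `(X + X*)/2` of a complex matrix. -/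
def reM {ι : Type*} (X : Matrix ι ι ℂ) : Matrix ι ι ℂ := (2 : ℂ)⁻¹ • (X + Xᴴ)

section Top

variable [TopologicalSpace V]

/-- `(Φ, α)` matricially exposes the point `A ∈ K_n`. -/
def IsExposingPair (K : ∀ n : ℕ, Set (Matrix (Fin n) (Fin n) V)) {n : ℕ}
    (A : Matrix (Fin n) (Fin n) V)
    (Φ : V →L[ℂ] Matrix (Fin n) (Fin n) ℂ) (α : Matrix (Fin n) (Fin n) ℂ) : Prop :=
  α.IsHermitian ∧
  (∀ r : ℕ, 0 < r → ∀ B ∈ K r,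
    (α ⊗ₖ (1 : Matrix (Fin r) (Fin r) ℂ) - reM (amplify (⇑Φ) B)).PosSemidef) ∧
  {B | B ∈ K n ∧
      (α ⊗ₖ (1 : Matrix (Fin n) (Fin n) ℂ) - reM (amplify (⇑Φ) B)).PosSemidef ∧
      ¬ IsUnit (α ⊗ₖ (1 : Matrix (Fin n) (Fin n) ℂ) - reM (amplify (⇑Φ) B))} =
    {B | ∃ U ∈ Matrix.unitaryGroup (Fin n) ℂ, B = mconj U A}

/-- `A ∈ K_n` is a matrix exposed point of `K`. -/
def IsMatrixExposed (K : ∀ n : ℕ, Set (Matrix (Fin n) (Fin n) V)) {n : ℕ}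
    (A : Matrix (Fin n) (Fin n) V) : Prop :=
  ∃ (Φ : V →L[ℂ] Matrix (Fin n) (Fin n) ℂ) (α : Matrix (Fin n) (Fin n) ℂ),
    IsExposingPair K A Φ α

end Top

/-- Classical exposed point of a set in a topological `ℂ`-vector space. -/
def IsExposedPoint {W : Type*} [AddCommGroup W] [Module ℂ W] [TopologicalSpace W]
    (C : Set W) (x : W) : Prop :=
  x ∈ C ∧ ∃ (φ : W →L[ℂ] ℂ) (a : ℝ),
    (φ x).re = a ∧ ∀ y ∈ C, y ≠ x → (φ y).re < a

/-- Classical exposed face of a set in a topological `ℂ`-vector space. -/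
def IsExposedFaceOf {W : Type*} [AddCommGroup W] [Module ℂ W] [TopologicalSpace W]
    (C F : Set W) : Prop :=
  F ⊆ C ∧ ∃ (φ : W →L[ℂ] ℂ) (a : ℝ),
    (∀ x ∈ F, (φ x).re = a) ∧ ∀ y ∈ C, y ∉ F → (φ y).re < a

/-- `A ∈ K_n` is a matrix extreme point of the graded family `K`. -/
def IsMatrixExtreme (K : ∀ n : ℕ, Set (Matrix (Fin n) (Fin n) V)) {n : ℕ}
    (A : Matrix (Fin n) (Fin n) V) : Prop :=
  A ∈ K n ∧
  ∀ (k : ℕ), 0 < k →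
    ∀ (ns : Fin k → ℕ) (Ai : ∀ i : Fin k, Matrix (Fin (ns i)) (Fin (ns i)) V)
      (γ : ∀ i : Fin k, Matrix (Fin (ns i)) (Fin n) ℂ),
      (∀ i, 0 < ns i) → (∀ i, Ai i ∈ K (ns i)) →
      (∀ i, Function.Surjective (γ i).mulVec) →
      (∑ i, (γ i)ᴴ * γ i) = 1 →
      (∑ i, mconj (γ i) (Ai i)) = A →
      ∀ i, ∃ (h : ns i = n) (U : Matrix (Fin n) (Fin n) ℂ),
        U ∈ Matrix.unitaryGroup (Fin n) ℂ ∧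
        Matrix.reindex (finCongr h) (finCongr h) (Ai i) = mconj U A

/-- `Γ_n(K)`. -/
def GammaSet (K : ∀ n : ℕ, Set (Matrix (Fin n) (Fin n) V)) (n : ℕ) :
    Set (Matrix (Fin n) (Fin n) ℂ × Matrix (Fin n) (Fin n) V) :=
  {P | ∃ (k : ℕ), 0 < k ∧ ∃ (A : Matrix (Fin k) (Fin k) V) (γ : Matrix (Fin k) (Fin n) ℂ),
    A ∈ K k ∧ (γᴴ * γ).trace = 1 ∧ P = (γᴴ * γ, mconj γ A)}

/-- Matrix face `F ⊆ K_n`. -/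
def IsMatrixFace (K : ∀ n : ℕ, Set (Matrix (Fin n) (Fin n) V)) {n : ℕ}
    (F : Set (Matrix (Fin n) (Fin n) V)) : Prop :=
  F ⊆ K n ∧ Convex ℝ F ∧
  ∀ (k : ℕ), 0 < k →
    ∀ (ns : Fin k → ℕ) (Ai : ∀ i : Fin k, Matrix (Fin (ns i)) (Fin (ns i)) V)
      (γ : ∀ i : Fin k, Matrix (Fin (ns i)) (Fin n) ℂ),
      (∀ i, 0 < ns i) → (∀ i, Ai i ∈ K (ns i)) →
      (∀ i, Function.Surjective (γ i).mulVec) →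
      (∑ i, (γ i)ᴴ * γ i) = 1 →
      (∑ i, mconj (γ i) (Ai i)) ∈ F →
      ∀ i, ∃ h : ns i = n, Matrix.reindex (finCongr h) (finCongr h) (Ai i) ∈ F

/-- `A` is a `C*`-extreme point of `F ⊆ M_n(V)`. -/
def IsCStarExtreme {n : ℕ} (F : Set (Matrix (Fin n) (Fin n) V))
    (A : Matrix (Fin n) (Fin n) V) : Prop :=
  A ∈ F ∧
  ∀ (k : ℕ), 0 < k →
    ∀ (Ai : Fin k → Matrix (Fin n) (Fin n) V) (γ : Fin k → Matrix (Fin n) (Fin n) ℂ),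
      (∀ i, Ai i ∈ F) → (∀ i, IsUnit (γ i)) →
      (∑ i, (γ i)ᴴ * γ i) = 1 →
      (∑ i, mconj (γ i) (Ai i)) = A →
      ∀ i, ∃ U ∈ Matrix.unitaryGroup (Fin n) ℂ, Ai i = mconj U A

section Top2

variable [TopologicalSpace V]

/-- `(Φ, α)` is an exposing pair for the face `F ⊆ K_n`. -/
def IsFaceExposingPair (K : ∀ n : ℕ, Set (Matrix (Fin n) (Fin n) V)) {n : ℕ}
    (F : Set (Matrix (Fin n) (Fin n) V))
    (Φ : V →L[ℂ] Matrix (Fin n) (Fin n) ℂ) (α : Matrix (Fin n) (Fin n) ℂ) : Prop :=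
  α.IsHermitian ∧
  (∀ m : ℕ, 0 < m → ∀ B ∈ K m,
    (α ⊗ₖ (1 : Matrix (Fin m) (Fin m) ℂ) - reM (amplify (⇑Φ) B)).PosSemidef) ∧
  (∀ m : ℕ, 0 < m → m < n → ∀ B ∈ K m,
    (α ⊗ₖ (1 : Matrix (Fin m) (Fin m) ℂ) - reM (amplify (⇑Φ) B)).PosDef) ∧
  {B | B ∈ K n ∧
      (α ⊗ₖ (1 : Matrix (Fin n) (Fin n) ℂ) - reM (amplify (⇑Φ) B)).PosSemidef ∧
      ¬ IsUnit (α ⊗ₖ (1 : Matrix (Fin n) (Fin n) ℂ) - reM (amplify (⇑Φ) B))} = F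

/-- `F ⊆ K_n` is a matrix exposed face of `K`. -/
def IsMatrixExposedFace (K : ∀ n : ℕ, Set (Matrix (Fin n) (Fin n) V)) {n : ℕ}
    (F : Set (Matrix (Fin n) (Fin n) V)) : Prop :=
  F ⊆ K n ∧ Convex ℝ F ∧
  ∃ (Φ : V →L[ℂ] Matrix (Fin n) (Fin n) ℂ) (α : Matrix (Fin n) (Fin n) ℂ),
    IsFaceExposingPair K F Φ α

/-- The unitary orbit of `F ⊆ M_n(V)`. -/
def unitaryOrbit {n : ℕ} (F : Set (Matrix (Fin n) (Fin n) V)) :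
    Set (Matrix (Fin n) (Fin n) V) :=
  {B | ∃ A ∈ F, ∃ U ∈ Matrix.unitaryGroup (Fin n) ℂ, B = mconj U A}

/-- `F ⊆ K_n` is a weak matrix exposed face of `K`. -/
def IsWeakMatrixExposedFace (K : ∀ n : ℕ, Set (Matrix (Fin n) (Fin n) V)) {n : ℕ}
    (F : Set (Matrix (Fin n) (Fin n) V)) : Prop :=
  F ⊆ K n ∧ Convex ℝ F ∧
  ∃ (Φ : V →L[ℂ] Matrix (Fin n) (Fin n) ℂ) (α : Matrix (Fin n) (Fin n) ℂ),
    α.IsHermitian ∧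
    (∀ m : ℕ, 0 < m → ∀ B ∈ K m,
      (α ⊗ₖ (1 : Matrix (Fin m) (Fin m) ℂ) - reM (amplify (⇑Φ) B)).PosSemidef) ∧
    (∀ m : ℕ, 0 < m → m < n → ∀ B ∈ K m,
      (α ⊗ₖ (1 : Matrix (Fin m) (Fin m) ℂ) - reM (amplify (⇑Φ) B)).PosDef) ∧
    {B | B ∈ K n ∧
        (α ⊗ₖ (1 : Matrix (Fin n) (Fin n) ℂ) - reM (amplify (⇑Φ) B)).PosSemidef ∧
        ¬ IsUnit (α ⊗ₖ (1 : Matrix (Fin n) (Fin n) ℂ) - reM (amplify (⇑Φ) B))} =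
      unitaryOrbit F

end Top2

/-- `F = (F_n)` is a matrix multiface of `K`. -/
def IsMatrixMultiface (K F : ∀ n : ℕ, Set (Matrix (Fin n) (Fin n) V)) : Prop :=
  (∀ n, F n ⊆ K n) ∧ (∀ n, Convex ℝ (F n)) ∧
  ∀ (k n : ℕ), 0 < k → 0 < n →
    ∀ (ns : Fin k → ℕ) (Ai : ∀ i : Fin k, Matrix (Fin (ns i)) (Fin (ns i)) V)
      (γ : ∀ i : Fin k, Matrix (Fin (ns i)) (Fin n) ℂ),
      (∀ i, 0 < ns i) → (∀ i, Ai i ∈ K (ns i)) →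
      (∀ i, Function.Surjective (γ i).mulVec) →
      (∑ i, (γ i)ᴴ * γ i) = 1 →
      (∑ i, mconj (γ i) (Ai i)) ∈ F n →
      ∀ i, Ai i ∈ F (ns i)

section Top3

variable [TopologicalSpace V]

/-- `F = (F_n)` is a matrix exposed multiface of `K`. -/
def IsMatrixExposedMultiface (K F : ∀ n : ℕ, Set (Matrix (Fin n) (Fin n) V)) : Prop :=
  (∀ n, F n ⊆ K n) ∧ (∀ n, Convex ℝ (F n)) ∧
  ∃ (r : ℕ), 0 < r ∧
    ∃ (Φ : V →L[ℂ] Matrix (Fin r) (Fin r) ℂ) (α : Matrix (Fin r) (Fin r) ℂ),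
      α.IsHermitian ∧
      (∀ n : ℕ, 0 < n → ∀ B ∈ K n,
        (α ⊗ₖ (1 : Matrix (Fin n) (Fin n) ℂ) - reM (amplify (⇑Φ) B)).PosSemidef) ∧
      (∀ n : ℕ, 0 < n →
        {B | B ∈ K n ∧
            (α ⊗ₖ (1 : Matrix (Fin n) (Fin n) ℂ) - reM (amplify (⇑Φ) B)).PosSemidef ∧
            ¬ IsUnit (α ⊗ₖ (1 : Matrix (Fin n) (Fin n) ℂ) - reM (amplify (⇑Φ) B))} = F n)

end Top3

end

/-- Matrix convexity with combinations indexed by an arbitrary nonempty finite type and all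
points of size one. -/
theorem IsMatrixConvex.sum_mconj_one_mem {V : Type*} [AddCommGroup V] [Module ℂ V]
    {K : ∀ n : ℕ, Set (Matrix (Fin n) (Fin n) V)} (hK : IsMatrixConvex K)
    {ι : Type*} [Fintype ι] [Nonempty ι] {n : ℕ} (hn : 0 < n)
    (A : ι → Matrix (Fin 1) (Fin 1) V) (γ : ι → Matrix (Fin 1) (Fin n) ℂ)
    (hA : ∀ i, A i ∈ K 1) (hγ : ∑ i, (γ i)ᴴ * γ i = 1) :
    ∑ i, mconj (γ i) (A i) ∈ K n := by
  let e := Fintype.equivFin ι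
  have h := hK (Fintype.card ι) n Fintype.card_pos hn (fun _ => 1)
    (fun i => A (e.symm i)) (fun i => γ (e.symm i)) (fun _ => one_pos) (fun i => hA _)
    (by rw [Equiv.sum_comp e.symm fun i => (γ i)ᴴ * γ i]; exact hγ)
  rwa [Equiv.sum_comp e.symm fun i => mconj (γ i) (A i)] at h

/-- The row `s (e_k + i^m e_l)`, where `s ^ 2 = 1 / (8 n)`. -/
noncomputable def polarRow (n : ℕ) (x : Fin n × Fin n × Fin 4) : Matrix (Fin 1) (Fin n) ℂ :=
  Matrix.of fun _ j => ((√(1 / (8 * n : ℝ)) : ℝ) : ℂ) *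
    ((if x.1 = j then 1 else 0) + Complex.I ^ (x.2.2 : ℕ) * (if x.2.1 = j then 1 else 0))

theorem star_polarRow_mul_polarRow (n : ℕ) (k l : Fin n) (m : Fin 4) (i j : Fin n) :
    star (polarRow n (k, l, m) 0 i) * polarRow n (k, l, m) 0 j =
      (1 / (8 * n) : ℂ) *
        (((if k = i then 1 else 0) + (-Complex.I) ^ (m : ℕ) * (if l = i then 1 else 0)) *
          ((if k = j then 1 else 0) + Complex.I ^ (m : ℕ) * (if l = j then 1 else 0))) := by
  have hs : ((√(1 / (8 * n : ℝ)) : ℝ) : ℂ) * ((√(1 / (8 * n : ℝ)) : ℝ) : ℂ) = 1 / (8 * n) := by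
    rw [← Complex.ofReal_mul, Real.mul_self_sqrt (by positivity)]
    push_cast
    rfl
  simp only [polarRow, Matrix.of_apply, star_mul', star_add, star_pow, RCLike.star_def,
    Complex.conj_ofReal, Complex.conj_I, apply_ite (starRingEnd ℂ), map_one, map_zero]
  rw [← hs]
  ring

theorem sum_star_polarRow_mul_polarRow (n : ℕ) (k l i j : Fin n) :
    ∑ m : Fin 4, star (polarRow n (k, l, m) 0 i) * polarRow n (k, l, m) 0 j =
      (1 / (2 * n) : ℂ) * ((if k = i then 1 else 0) * (if k = j then 1 else 0) +
        (if l = i then 1 else 0) * (if l = j then 1 else 0)) := by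
  simp only [star_polarRow_mul_polarRow, Fin.sum_univ_four]
  have h : Complex.I ^ 3 = -Complex.I := Complex.I_pow_three
  generalize (if k = i then (1 : ℂ) else 0) = a
  generalize (if k = j then (1 : ℂ) else 0) = b
  generalize (if l = i then (1 : ℂ) else 0) = c
  generalize (if l = j then (1 : ℂ) else 0) = d
  simp [Odd.neg_pow (show Odd 3 by decide), h]
  ring_nf
  simp [Complex.I_sq]
  ring

theorem sum_star_polarRow_mul_polarRow_mul (n : ℕ) (hn : 0 < n) (k l i j : Fin n) :
    ∑ m : Fin 4, star (polarRow n (k, l, m) 0 i) * polarRow n (k, l, m) 0 j *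
        (2 * n * (-Complex.I) ^ (m : ℕ)) =
      (if k = i then 1 else 0) * (if l = j then 1 else 0) := by
  have hn' : (n : ℂ) ≠ 0 := by exact_mod_cast hn.ne'
  simp only [star_polarRow_mul_polarRow, Fin.sum_univ_four]
  have h : Complex.I ^ 3 = -Complex.I := Complex.I_pow_three
  generalize (if k = i then (1 : ℂ) else 0) = a
  generalize (if k = j then (1 : ℂ) else 0) = b
  generalize (if l = i then (1 : ℂ) else 0) = c
  generalize (if l = j then (1 : ℂ) else 0) = d
  simp [Odd.neg_pow (show Odd 3 by decide), h]
  field_simp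
  ring_nf
  simp [Complex.I_sq]
  ring

theorem sum_conjTranspose_polarRow_mul (n : ℕ) (hn : 0 < n) :
    ∑ x, (polarRow n x)ᴴ * polarRow n x = 1 := by
  have hn' : (n : ℂ) ≠ 0 := by exact_mod_cast hn.ne'
  ext i j
  simp only [Matrix.sum_apply, Matrix.mul_apply, Matrix.conjTranspose_apply,
    Finset.univ_unique, Fin.default_eq_zero, Finset.sum_singleton, Fintype.sum_prod_type,
    sum_star_polarRow_mul_polarRow, ← Finset.mul_sum, Finset.sum_add_distrib]
  rcases eq_or_ne i j with rfl | hij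
  · simp
    field_simp
    norm_num
  · simp [hij, hij.symm]

theorem sum_mconj_polarRow {V : Type*} [AddCommGroup V] [Module ℂ V] {n : ℕ} (hn : 0 < n)
    (v : V) (X : Matrix (Fin n) (Fin n) V) :
    ∑ x : Fin n × Fin n × Fin 4, mconj (polarRow n x)
        (Matrix.of fun _ _ : Fin 1 => v + (2 * n * (-Complex.I) ^ (x.2.2 : ℕ)) • X x.1 x.2.1) =
      (Matrix.of fun i j : Fin n => if i = j then v else 0) + X := by
  ext i j
  have h := congrFun (congrFun (sum_conjTranspose_polarRow_mul n hn) i) j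
  simp only [Matrix.sum_apply, Matrix.mul_apply, Matrix.conjTranspose_apply,
    Finset.univ_unique, Fin.default_eq_zero, Finset.sum_singleton] at h
  simp only [Matrix.sum_apply, mconj, Matrix.of_apply, Finset.univ_unique, Fin.default_eq_zero,
    Finset.sum_singleton, smul_add, Finset.sum_add_distrib, ← Finset.sum_smul, h, smul_smul,
    Matrix.add_apply]
  congr 1
  · simp [Matrix.one_apply]
  · simp only [Fintype.sum_prod_type, ← Finset.sum_smul,
      sum_star_polarRow_mul_polarRow_mul n hn]
    simp

section Statements

variable {E F' : Type*} [AddCommGroup E] [Module ℂ E] [AddCommGroup F'] [Module ℂ F']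
theorem interior_diag_mem
    (p : E →ₗ[ℂ] F' →ₗ[ℂ] ℂ)
    (K : ∀ n : ℕ, Set (Matrix (Fin n) (Fin n) (WeakBilin p)))
    (hK : IsMatrixConvex K)
    (v : Matrix (Fin 1) (Fin 1) (WeakBilin p)) (hv : v ∈ interior (K 1))
    (n : ℕ) (hn : 0 < n) :
    (Matrix.of fun i j : Fin n => if i = j then v 0 0 else 0) ∈ interior (K n) := by
  let D : Matrix (Fin n) (Fin n) (WeakBilin p) :=
    Matrix.of fun i j : Fin n => if i = j then v 0 0 else 0
  let f : Fin n × Fin n × Fin 4 → Matrix (Fin n) (Fin n) (WeakBilin p) →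
      Matrix (Fin 1) (Fin 1) (WeakBilin p) := fun x B =>
    Matrix.of fun _ _ => v 0 0 + (2 * n * (-Complex.I) ^ (x.2.2 : ℕ)) • (B - D) x.1 x.2.1
  have hf : ∀ x, Continuous (f x) := fun x =>
    continuous_matrix fun _ _ => continuous_const.add
      (((continuous_id.sub continuous_const).matrix_elem _ _).const_smul _)
  have hfD : ∀ x, f x D = v := fun x => by
    ext i j
    simp [f, Subsingleton.elim i 0, Subsingleton.elim j 0]
  have : Nonempty (Fin n × Fin n × Fin 4) := ⟨(⟨0, hn⟩, ⟨0, hn⟩, 0)⟩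
  refine mem_interior.2 ⟨⋂ x, f x ⁻¹' interior (K 1), fun B hB => ?_,
    isOpen_iInter_of_finite fun x => isOpen_interior.preimage (hf x),
    Set.mem_iInter.2 fun x => ?_⟩
  · have h := hK.sum_mconj_one_mem hn (fun x => f x B) (polarRow n)
      (fun x => interior_subset (Set.mem_iInter.1 hB x)) (sum_conjTranspose_polarRow_mul n hn)
    rwa [sum_mconj_polarRow hn (v 0 0) (B - D), add_sub_cancel] at h
  · change f x D ∈ interior (K 1)
    rwa [hfD x]

end Statements
end

section
/- Let K = (K_n)_{n≥1} be a matrix convex set in V with 0 ∈ K₁ and K₁ containing a nonzero point. Then a point A ∈ K₁ is a matrix exposed point of K if and only if A is an exposed point of the convex set K₁ ⊆ V. -/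
open scoped Matrix Kronecker ComplexOrder

/-- The quadratic form of `reM X` is the real part of the quadratic form of `X`. -/
theorem star_dotProduct_reM_mulVec {ι : Type*} [Fintype ι] (X : Matrix ι ι ℂ) (x : ι → ℂ) :
    star x ⬝ᵥ (reM X *ᵥ x) = ((star x ⬝ᵥ (X *ᵥ x)).re : ℂ) := by
  have h : star x ⬝ᵥ (Xᴴ *ᵥ x) = star (star x ⬝ᵥ (X *ᵥ x)) := by
    rw [Matrix.star_dotProduct, Matrix.star_mulVec, Matrix.conjTranspose_conjTranspose,
      ← Matrix.dotProduct_mulVec]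
  rw [reM, Matrix.smul_mulVec, Matrix.add_mulVec, dotProduct_smul, dotProduct_add, h,
    Complex.re_eq_add_conj, starRingEnd_apply, smul_eq_mul]
  ring

theorem isHermitian_reM {ι : Type*} (X : Matrix ι ι ℂ) : (reM X).IsHermitian := by
  simp [Matrix.IsHermitian, reM, Matrix.conjTranspose_smul, add_comm]

/-- Compressing `B` to a scalar by a column `γ` corresponds to evaluating the quadratic form of
the ampliation at that column. -/
theorem apply_mconj_column {V : Type*} [AddCommGroup V] [Module ℂ V] {r : ℕ}
    (Φ : V →ₗ[ℂ] Matrix (Fin 1) (Fin 1) ℂ) (B : Matrix (Fin r) (Fin r) V)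
    (y : Fin 1 × Fin r → ℂ) :
    Φ (mconj (Matrix.of fun k (_ : Fin 1) => y (0, k)) B 0 0) 0 0 =
      star y ⬝ᵥ (amplify (⇑Φ) B *ᵥ y) := by
  simp only [mconj, Matrix.of_apply, map_sum, map_smul, Matrix.sum_apply, Matrix.smul_apply,
    dotProduct, Matrix.mulVec, amplify, Fintype.sum_prod_type, Finset.univ_unique,
    Finset.sum_singleton, Fin.default_eq_zero, Pi.star_apply, smul_eq_mul, Finset.mul_sum]
  refine Finset.sum_congr rfl fun k _ => Finset.sum_congr rfl fun l _ => by ring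

/-- A unit column compresses a matrix convex set into its first level. -/
theorem IsMatrixConvex.mconj_column_mem {V : Type*} [AddCommGroup V] [Module ℂ V]
    {K : ∀ n : ℕ, Set (Matrix (Fin n) (Fin n) V)} (hK : IsMatrixConvex K) {r : ℕ} (hr : 0 < r)
    {B : Matrix (Fin r) (Fin r) V} (hB : B ∈ K r) {γ : Matrix (Fin r) (Fin 1) ℂ}
    (hγ : γᴴ * γ = 1) : mconj γ B ∈ K 1 := by
  simpa using hK 1 1 one_pos one_pos (fun _ => r) (fun _ => B) (fun _ => γ)
    (fun _ => hr) (fun _ => hB) (by simpa using hγ)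

/-- A unitary of size one acts trivially. -/
theorem mconj_unitary_one {V : Type*} [AddCommGroup V] [Module ℂ V]
    {U : Matrix (Fin 1) (Fin 1) ℂ} (hU : U ∈ Matrix.unitaryGroup (Fin 1) ℂ)
    (A : Matrix (Fin 1) (Fin 1) V) : mconj U A = A := by
  have h := congrFun (congrFun (Matrix.mem_unitaryGroup_iff'.mp hU) 0) 0
  simp only [Matrix.mul_apply, Finset.univ_unique, Finset.sum_singleton, Fin.default_eq_zero,
    Matrix.star_apply, Matrix.one_apply_eq] at h
  ext i j
  fin_cases i; fin_cases j
  simp only [mconj, Matrix.of_apply, Finset.univ_unique, Finset.sum_singleton,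
    Fin.default_eq_zero, Fin.zero_eta, h, one_smul]

theorem setOf_mconj_unitary_one {V : Type*} [AddCommGroup V] [Module ℂ V]
    (A : Matrix (Fin 1) (Fin 1) V) :
    {B | ∃ U ∈ Matrix.unitaryGroup (Fin 1) ℂ, B = mconj U A} = {A} := by
  ext B
  constructor
  · rintro ⟨U, hU, rfl⟩
    exact mconj_unitary_one hU A
  · rintro rfl
    exact ⟨1, one_mem _, (mconj_unitary_one (one_mem _) _).symm⟩

/-- At level one the defect `α ⊗ I - Re Φ(B)` is a real scalar. -/
theorem level_one_defect {V : Type*} [AddCommGroup V] {α : Matrix (Fin 1) (Fin 1) ℂ}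
    (hα : α.IsHermitian) (Φ : V → Matrix (Fin 1) (Fin 1) ℂ) (B : Matrix (Fin 1) (Fin 1) V) :
    α ⊗ₖ (1 : Matrix (Fin 1) (Fin 1) ℂ) - reM (amplify Φ B) =
      Matrix.diagonal fun _ => (((α 0 0).re - (Φ (B 0 0) 0 0).re : ℝ) : ℂ) := by
  have h := hα.coe_re_apply_self 0
  ext ⟨i, j⟩ ⟨k, l⟩
  fin_cases i; fin_cases j; fin_cases k; fin_cases l
  simp only [RCLike.re_to_complex, Complex.coe_algebraMap] at h
  simp [reM, amplify, Complex.re_eq_add_conj (Φ (B 0 0) 0 0), h]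
  ring

theorem level_one_defect_posSemidef_iff {V : Type*} [AddCommGroup V]
    {α : Matrix (Fin 1) (Fin 1) ℂ} (hα : α.IsHermitian) (Φ : V → Matrix (Fin 1) (Fin 1) ℂ)
    (B : Matrix (Fin 1) (Fin 1) V) :
    (α ⊗ₖ (1 : Matrix (Fin 1) (Fin 1) ℂ) - reM (amplify Φ B)).PosSemidef ↔
      (Φ (B 0 0) 0 0).re ≤ (α 0 0).re := by
  rw [level_one_defect hα, Matrix.posSemidef_diagonal_iff]
  simp only [forall_const, Complex.zero_le_real, sub_nonneg]

theorem level_one_defect_isUnit_iff {V : Type*} [AddCommGroup V]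
    {α : Matrix (Fin 1) (Fin 1) ℂ} (hα : α.IsHermitian) (Φ : V → Matrix (Fin 1) (Fin 1) ℂ)
    (B : Matrix (Fin 1) (Fin 1) V) :
    IsUnit (α ⊗ₖ (1 : Matrix (Fin 1) (Fin 1) ℂ) - reM (amplify Φ B)) ↔
      (Φ (B 0 0) 0 0).re ≠ (α 0 0).re := by
  rw [level_one_defect hα, Matrix.isUnit_diagonal, Pi.isUnit_iff]
  simp only [forall_const, isUnit_iff_ne_zero, ne_eq, Complex.ofReal_eq_zero, sub_eq_zero]
  exact not_congr eq_comm

/-- A real bound for a functional on the first level of a matrix convex set extends to all its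
ampliations. -/
theorem IsMatrixConvex.posSemidef_of_level_one {V : Type*} [AddCommGroup V] [Module ℂ V]
    {K : ∀ n : ℕ, Set (Matrix (Fin n) (Fin n) V)} (hK : IsMatrixConvex K)
    (Φ : V →ₗ[ℂ] Matrix (Fin 1) (Fin 1) ℂ) {a : ℝ}
    (h : ∀ C ∈ K 1, (Φ (C 0 0) 0 0).re ≤ a) {r : ℕ} (hr : 0 < r)
    {B : Matrix (Fin r) (Fin r) V} (hB : B ∈ K r) :
    ((Matrix.diagonal fun _ => (a : ℂ)) ⊗ₖ (1 : Matrix (Fin r) (Fin r) ℂ) -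
      reM (amplify (⇑Φ) B)).PosSemidef := by
  have hd : (Matrix.diagonal fun _ : Fin 1 => (a : ℂ)) ⊗ₖ (1 : Matrix (Fin r) (Fin r) ℂ) =
      (a : ℂ) • 1 := by
    rw [← Matrix.smul_one_eq_diagonal, Matrix.smul_kronecker, Matrix.one_kronecker_one]
  rw [hd]
  refine Matrix.PosSemidef.of_dotProduct_mulVec_nonneg
    (Matrix.IsHermitian.sub ?_ (isHermitian_reM _)) fun x => ?_
  · simp [Matrix.IsHermitian, Matrix.conjTranspose_smul]
  set s : ℝ := ∑ k, ‖x (0, k)‖ ^ 2 with hs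
  have hxx : star x ⬝ᵥ x = (s : ℂ) := by
    simp [hs, dotProduct, Fintype.sum_prod_type, Complex.conj_mul']
  rw [Matrix.sub_mulVec, dotProduct_sub, star_dotProduct_reM_mulVec, Matrix.smul_mulVec,
    Matrix.one_mulVec, dotProduct_smul, hxx, smul_eq_mul, ← Complex.ofReal_mul,
    ← Complex.ofReal_sub, Complex.zero_le_real, sub_nonneg]
  rcases (show 0 ≤ s by positivity).eq_or_lt with h0 | hpos
  · have : x = 0 := by
      rw [← dotProduct_star_self_eq_zero, hxx, ← h0, Complex.ofReal_zero]
    simp [this, ← h0]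
  set c : ℝ := (√s)⁻¹ with hc
  have hcs : c * c * s = 1 := by
    rw [hc, ← mul_inv, Real.mul_self_sqrt hpos.le, inv_mul_cancel₀ hpos.ne']
  set y : Fin 1 × Fin r → ℂ := (c : ℂ) • x with hy
  have hquad (M : Matrix (Fin 1 × Fin r) (Fin 1 × Fin r) ℂ) :
      star y ⬝ᵥ (M *ᵥ y) = ((c * c : ℝ) : ℂ) * (star x ⬝ᵥ (M *ᵥ x)) := by
    simp [hy, Matrix.mulVec_smul, mul_assoc]
  have hyy : star y ⬝ᵥ y = 1 := by
    have := hquad 1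
    rwa [Matrix.one_mulVec, Matrix.one_mulVec, hxx, ← Complex.ofReal_mul, hcs,
      Complex.ofReal_one] at this
  have hmem := h _ (hK.mconj_column_mem hr hB
    (γ := Matrix.of fun k (_ : Fin 1) => y (0, k)) (by
      ext i j
      fin_cases i; fin_cases j
      simpa [dotProduct, Fintype.sum_prod_type, Matrix.mul_apply] using hyy))
  rw [apply_mconj_column, hquad, Complex.re_ofReal_mul] at hmem
  calc _ = s * (c * c * (star x ⬝ᵥ (amplify (⇑Φ) B *ᵥ x)).re) := by
        rw [← mul_assoc, mul_comm s, hcs, one_mul]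
    _ ≤ s * a := mul_le_mul_of_nonneg_left hmem hpos.le
    _ = a * s := mul_comm _ _

/-- Every functional on `M_1(V)` is an entry functional of a map `V → M_1(ℂ)`. -/
theorem exists_entry_functional {V : Type*} [AddCommGroup V] [Module ℂ V] [TopologicalSpace V]
    (φ : Matrix (Fin 1) (Fin 1) V →L[ℂ] ℂ) :
    ∃ Φ : V →L[ℂ] Matrix (Fin 1) (Fin 1) ℂ,
      ∀ B : Matrix (Fin 1) (Fin 1) V, Φ (B 0 0) 0 0 = φ B := by
  let L : V →ₗ[ℂ] Matrix (Fin 1) (Fin 1) V :=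
    { toFun := fun v => Matrix.of fun _ _ => v
      map_add' := fun _ _ => rfl
      map_smul' := fun _ _ => rfl }
  let M : ℂ →ₗ[ℂ] Matrix (Fin 1) (Fin 1) ℂ :=
    { toFun := fun v => Matrix.of fun _ _ => v
      map_add' := fun _ _ => rfl
      map_smul' := fun _ _ => rfl }
  have hL : Continuous L := continuous_matrix fun _ _ => continuous_id
  have hM : Continuous M := continuous_matrix fun _ _ => continuous_id
  refine ⟨(⟨M, hM⟩ : ℂ →L[ℂ] _).comp (φ.comp ⟨L, hL⟩), fun B => ?_⟩
  have hB : L (B 0 0) = B := by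
    ext i j
    fin_cases i; fin_cases j; rfl
  exact congrArg φ hB

/-- Matrix exposed points at level one are the exposed points of the first level. -/
theorem IsMatrixConvex.isMatrixExposed_one_iff {V : Type*} [AddCommGroup V] [Module ℂ V]
    [TopologicalSpace V] {K : ∀ n : ℕ, Set (Matrix (Fin n) (Fin n) V)} (hK : IsMatrixConvex K)
    {A : Matrix (Fin 1) (Fin 1) V} (hA : A ∈ K 1) :
    IsMatrixExposed K A ↔ IsExposedPoint (K 1) A := by
  constructor
  · rintro ⟨Φ, α, hα, hle, hset⟩
    rw [setOf_mconj_unitary_one] at hset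
    have hmem (B : Matrix (Fin 1) (Fin 1) V) := Set.ext_iff.mp hset B
    simp only [Set.mem_ofPred_eq, Set.mem_singleton_iff, level_one_defect_posSemidef_iff hα,
      level_one_defect_isUnit_iff hα, not_not] at hmem
    refine ⟨hA, ⟨{ toFun := fun B => Φ (B 0 0) 0 0
                   map_add' := by simp
                   map_smul' := by simp }, ?_⟩, (α 0 0).re, ((hmem A).mpr rfl).2.2, ?_⟩
    · exact (Φ.continuous.comp (continuous_id.matrix_elem 0 0)).matrix_elem 0 0
    · intro B hB hne
      have hB' := (level_one_defect_posSemidef_iff hα _ _).mp (hle 1 one_pos B hB)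
      exact lt_of_le_of_ne hB' fun he => hne ((hmem B).mp ⟨hB, hB', he⟩)
  · rintro ⟨-, φ, a, hAa, hlt⟩
    obtain ⟨Φ, hΦ⟩ := exists_entry_functional φ
    have hα : (Matrix.diagonal fun _ : Fin 1 => (a : ℂ)).IsHermitian :=
      Matrix.isHermitian_diagonal_of_self_adjoint _ (by ext; simp)
    have hle (B) (hB : B ∈ K 1) : (φ B).re ≤ a := by
      by_cases h : B = A
      · rw [h, hAa]
      · exact (hlt B hB h).le
    have hle' (C) (hC : C ∈ K 1) : ((Φ : V →ₗ[ℂ] Matrix (Fin 1) (Fin 1) ℂ) (C 0 0) 0 0).re ≤ a :=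
      (congrArg Complex.re (hΦ C)).trans_le (hle C hC)
    refine ⟨Φ, Matrix.diagonal fun _ => (a : ℂ), hα, ?_, ?_⟩
    · intro r hr B hB
      exact hK.posSemidef_of_level_one (Φ : V →ₗ[ℂ] Matrix (Fin 1) (Fin 1) ℂ) hle' hr hB
    · rw [setOf_mconj_unitary_one]
      ext B
      simp only [Set.mem_ofPred_eq, Set.mem_singleton_iff, level_one_defect_posSemidef_iff hα,
        level_one_defect_isUnit_iff hα, not_not, hΦ, Matrix.diagonal_apply_eq, Complex.ofReal_re]
      constructor
      · rintro ⟨hB, -, he⟩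
        by_contra hne
        exact (hlt B hB hne).ne he
      · rintro rfl
        exact ⟨hA, hAa.le, hAa⟩

section Statements

variable {E F' : Type*} [AddCommGroup E] [Module ℂ E] [AddCommGroup F'] [Module ℂ F']
theorem matrixExposed_iff_exposed_at_level_one
    (p : E →ₗ[ℂ] F' →ₗ[ℂ] ℂ)
    (K : ∀ n : ℕ, Set (Matrix (Fin n) (Fin n) (WeakBilin p)))
    (hK : IsMatrixConvex K)
    (h0 : (0 : Matrix (Fin 1) (Fin 1) (WeakBilin p)) ∈ K 1)
    (hnz : ∃ w ∈ K 1, w ≠ 0)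
    (A : Matrix (Fin 1) (Fin 1) (WeakBilin p)) (hA : A ∈ K 1) :
    IsMatrixExposed K A ↔ IsExposedPoint (K 1) A :=
  hK.isMatrixExposed_one_iff hA

end Statements
end

section
/- Let K = (K_n)_{n≥1} be a matrix convex set in V with 0 ∈ K₁ and K₁ containing a nonzero point, and let A ∈ K_n be a matrix exposed point of K with exposing pair (Φ, α). Then: (a) for every nonzero x ∈ ℂ^n ⊗ ℂ^n with (α ⊗ I_n − Re Φ_n(A)) x = 0, writing x = Σ_{j=1}^n x_j ⊗ e_j with x_j ∈ ℂ^n and (e_j) the standard basis, the vectors x_1, …, x_n form a basis of ℂ^n; (b) the kernel of α ⊗ I_n − Re Φ_n(A) is one-dimensional. -/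
open scoped Matrix Kronecker ComplexOrder

section Helpers

variable {V : Type*} [AddCommGroup V] [Module ℂ V]

theorem amplify_mconj {m s r : ℕ} (Φ : V →ₗ[ℂ] Matrix (Fin m) (Fin m) ℂ)
    (γ : Matrix (Fin s) (Fin r) ℂ) (B : Matrix (Fin s) (Fin s) V) :
    amplify (⇑Φ) (mconj γ B) =
      ((1 : Matrix (Fin m) (Fin m) ℂ) ⊗ₖ γ)ᴴ * amplify (⇑Φ) B *
        ((1 : Matrix (Fin m) (Fin m) ℂ) ⊗ₖ γ) := by
  ext ⟨i, j⟩ ⟨i', j'⟩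
  simp only [amplify, mconj, Matrix.of_apply, map_sum, map_smul, Matrix.sum_apply,
    Matrix.smul_apply, smul_eq_mul, Matrix.mul_apply, Fintype.sum_prod_type,
    Matrix.conjTranspose_apply, Matrix.kroneckerMap_apply, Matrix.one_apply, apply_ite star,
    star_zero, ite_mul, mul_ite, one_mul, zero_mul, mul_zero,
    Finset.sum_ite_irrel, Finset.sum_const_zero, Finset.sum_ite_eq',
    Finset.mem_univ, if_true]
  rw [Finset.sum_comm]
  refine Finset.sum_congr rfl fun l _ => ?_
  rw [Finset.sum_mul]
  exact Finset.sum_congr rfl fun k _ => by ring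

theorem amplify_add {m r : ℕ} (Φ : V →ₗ[ℂ] Matrix (Fin m) (Fin m) ℂ)
    (B C : Matrix (Fin r) (Fin r) V) :
    amplify (⇑Φ) (B + C) = amplify (⇑Φ) B + amplify (⇑Φ) C := by
  ext p q
  simp [amplify]

theorem reM_add {ι : Type*} (X Y : Matrix ι ι ℂ) : reM (X + Y) = reM X + reM Y := by
  simp only [reM, Matrix.conjTranspose_add, ← smul_add]
  congr 1
  abel

theorem reM_conj {ι κ : Type*} [Fintype ι] [Fintype κ] (G : Matrix ι κ ℂ) (X : Matrix ι ι ℂ) :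
    reM (Gᴴ * X * G) = Gᴴ * reM X * G := by
  simp only [reM, Matrix.conjTranspose_mul, Matrix.conjTranspose_conjTranspose, Matrix.mul_smul,
    Matrix.smul_mul, Matrix.mul_add, Matrix.add_mul, Matrix.mul_assoc]

theorem kronecker_one_conj {m s r : ℕ} (α : Matrix (Fin m) (Fin m) ℂ)
    (γ : Matrix (Fin s) (Fin r) ℂ) :
    ((1 : Matrix (Fin m) (Fin m) ℂ) ⊗ₖ γ)ᴴ * (α ⊗ₖ (1 : Matrix (Fin s) (Fin s) ℂ)) *
      ((1 : Matrix (Fin m) (Fin m) ℂ) ⊗ₖ γ) = α ⊗ₖ (γᴴ * γ) := by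
  rw [Matrix.conjTranspose_kronecker, ← Matrix.mul_kronecker_mul, ← Matrix.mul_kronecker_mul]
  simp

/-- The affine pencil `α ⊗ I - Re Φ(·)` respects two-term matrix convex combinations. -/
theorem pencil_mconj_add_mconj {m s t r : ℕ} (Φ : V →ₗ[ℂ] Matrix (Fin m) (Fin m) ℂ)
    (α : Matrix (Fin m) (Fin m) ℂ) (γ : Matrix (Fin s) (Fin r) ℂ) (δ : Matrix (Fin t) (Fin r) ℂ)
    (h : γᴴ * γ + δᴴ * δ = 1) (B : Matrix (Fin s) (Fin s) V) (C : Matrix (Fin t) (Fin t) V) :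
    α ⊗ₖ (1 : Matrix (Fin r) (Fin r) ℂ) - reM (amplify (⇑Φ) (mconj γ B + mconj δ C)) =
      ((1 : Matrix (Fin m) (Fin m) ℂ) ⊗ₖ γ)ᴴ * (α ⊗ₖ 1 - reM (amplify (⇑Φ) B)) *
          ((1 : Matrix (Fin m) (Fin m) ℂ) ⊗ₖ γ) +
        ((1 : Matrix (Fin m) (Fin m) ℂ) ⊗ₖ δ)ᴴ * (α ⊗ₖ 1 - reM (amplify (⇑Φ) C)) *
          ((1 : Matrix (Fin m) (Fin m) ℂ) ⊗ₖ δ) := by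
  rw [amplify_add, reM_add, amplify_mconj, amplify_mconj, reM_conj, reM_conj]
  simp only [Matrix.mul_sub, Matrix.sub_mul]
  rw [kronecker_one_conj, kronecker_one_conj, ← h, Matrix.kronecker_add]
  abel

theorem IsMatrixConvex.mconj_add_mconj_mem {K : ∀ n : ℕ, Set (Matrix (Fin n) (Fin n) V)}
    (hK : IsMatrixConvex K) {s t r : ℕ} (hs : 0 < s) (ht : 0 < t) (hr : 0 < r)
    {B : Matrix (Fin s) (Fin s) V} (hB : B ∈ K s) {C : Matrix (Fin t) (Fin t) V} (hC : C ∈ K t)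
    (γ : Matrix (Fin s) (Fin r) ℂ) (δ : Matrix (Fin t) (Fin r) ℂ)
    (h : γᴴ * γ + δᴴ * δ = 1) : mconj γ B + mconj δ C ∈ K r := by
  have key := hK 2 r two_pos hr (fun i => match i with | 0 => s | 1 => t)
    (fun i => match i with | 0 => B | 1 => C) (fun i => match i with | 0 => γ | 1 => δ)
    (by rw [Fin.forall_fin_two]; exact ⟨hs, ht⟩) (by rw [Fin.forall_fin_two]; exact ⟨hB, hC⟩)
    (by rw [Fin.sum_univ_two]; exact h)
  rw [Fin.sum_univ_two] at key
  exact key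

theorem mconj_one {n : ℕ} (A : Matrix (Fin n) (Fin n) V) : mconj 1 A = A := by
  ext i j
  simp [mconj, Matrix.one_apply, apply_ite star, ite_smul]

theorem trace_mconj {m n : ℕ} (γ : Matrix (Fin m) (Fin n) ℂ) (B : Matrix (Fin m) (Fin m) V) :
    (mconj γ B).trace = ∑ k, ∑ l, (γ * γᴴ) l k • B k l := by
  simp only [Matrix.trace, Matrix.diag, mconj, Matrix.of_apply, Matrix.mul_apply,
    Matrix.conjTranspose_apply, Finset.sum_smul]
  rw [Finset.sum_comm]
  refine Finset.sum_congr rfl fun k _ => ?_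
  rw [Finset.sum_comm]
  exact Finset.sum_congr rfl fun l _ => Finset.sum_congr rfl fun i _ => by rw [mul_comm]

theorem trace_mconj_of_mul_conjTranspose_eq_one {m n : ℕ} {γ : Matrix (Fin m) (Fin n) ℂ}
    (h : γ * γᴴ = 1) (B : Matrix (Fin m) (Fin m) V) : (mconj γ B).trace = B.trace := by
  rw [trace_mconj, h]
  simp [Matrix.one_apply, Matrix.trace]

theorem one_kronecker_mulVec_apply {m s r : ℕ} (γ : Matrix (Fin s) (Fin r) ℂ)
    (x : Fin m × Fin r → ℂ) (i : Fin m) (j : Fin s) :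
    ((1 : Matrix (Fin m) (Fin m) ℂ) ⊗ₖ γ).mulVec x (i, j) = ∑ l, γ j l * x (i, l) := by
  simp [Matrix.mulVec, dotProduct, Fintype.sum_prod_type, Matrix.kroneckerMap_apply,
    Matrix.one_apply, ite_mul, Finset.sum_ite_irrel]

theorem exists_row_coisometry {n : ℕ} {c : Fin n → ℂ} (hc : c ≠ 0) :
    ∃ (t : ℂ) (γ : Matrix (Fin 1) (Fin n) ℂ), (∀ i j, γ i j = t * c j) ∧ γ * γᴴ = 1 := by
  have hv : ‖WithLp.toLp 2 c‖ ≠ 0 := by simpa using hc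
  have hs := EuclideanSpace.norm_sq_eq (WithLp.toLp 2 c)
  refine ⟨((‖WithLp.toLp 2 c‖⁻¹ : ℝ) : ℂ),
    Matrix.of fun _ j => ((‖WithLp.toLp 2 c‖⁻¹ : ℝ) : ℂ) * c j, fun _ _ => rfl, ?_⟩
  generalize ‖WithLp.toLp 2 c‖ = a at hv hs
  ext i j
  rw [Subsingleton.elim i j, Matrix.one_apply_eq, Matrix.mul_apply]
  have h1 : ∀ l, (Matrix.of fun (_ : Fin 1) l => ((a⁻¹ : ℝ) : ℂ) * c l) j l *
      (Matrix.of fun (_ : Fin 1) l => ((a⁻¹ : ℝ) : ℂ) * c l)ᴴ l j =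
      ((a⁻¹ ^ 2 * ‖c l‖ ^ 2 : ℝ) : ℂ) := by
    intro l
    have h2 : c l * star (c l) = ((‖c l‖ ^ 2 : ℝ) : ℂ) := by
      simpa using Complex.mul_conj' (c l)
    have h3 : star ((a⁻¹ : ℝ) : ℂ) = ((a⁻¹ : ℝ) : ℂ) := Complex.conj_ofReal _
    rw [Matrix.conjTranspose_apply, Matrix.of_apply, star_mul', h3, mul_mul_mul_comm, h2]
    push_cast
    ring
  rw [Finset.sum_congr rfl fun l _ => h1 l, ← Complex.ofReal_sum, ← Finset.mul_sum]
  have h4 : ∑ l, ‖c l‖ ^ 2 = a ^ 2 := hs.symm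
  rw [h4, ← mul_pow, inv_mul_cancel₀ hv]
  simp

theorem proj_compl_convex {n : ℕ} {δ : Matrix (Fin 1) (Fin n) ℂ} (h : δ * δᴴ = 1) :
    (1 - δᴴ * δ)ᴴ * (1 - δᴴ * δ) + δᴴ * δ = 1 := by
  have hQ : δᴴ * δ * (δᴴ * δ) = δᴴ * δ := by
    rw [Matrix.mul_assoc, ← Matrix.mul_assoc δ, h, Matrix.one_mul]
  simp only [Matrix.conjTranspose_sub, Matrix.conjTranspose_one, Matrix.conjTranspose_mul,
    Matrix.conjTranspose_conjTranspose, Matrix.mul_sub, Matrix.sub_mul, Matrix.mul_one,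
    Matrix.one_mul, hQ]
  abel

variable [TopologicalSpace V]

/-- A kernel vector of an exposing pencil, viewed as a matrix, is injective. -/
theorem IsExposingPair.eq_zero_of_mulVec_eq_zero
    {K : ∀ n : ℕ, Set (Matrix (Fin n) (Fin n) V)} (hK : IsMatrixConvex K)
    (h0 : (0 : Matrix (Fin 1) (Fin 1) V) ∈ K 1) (hnz : ∃ w ∈ K 1, w ≠ 0)
    {n : ℕ} (hn : 0 < n) {A : Matrix (Fin n) (Fin n) V} (hA : A ∈ K n)
    {Φ : V →L[ℂ] Matrix (Fin n) (Fin n) ℂ} {α : Matrix (Fin n) (Fin n) ℂ}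
    (hexp : IsExposingPair K A Φ α) {x : Fin n × Fin n → ℂ} (hx : x ≠ 0)
    (hker : (α ⊗ₖ (1 : Matrix (Fin n) (Fin n) ℂ) - reM (amplify (⇑Φ) A)).mulVec x = 0)
    {c : Fin n → ℂ} (hc : (Matrix.of fun i j => x (i, j)).mulVec c = 0) : c = 0 := by
  by_contra hc0
  obtain ⟨t, δ, hδ, hδ1⟩ := exists_row_coisometry hc0
  have hδx : ((1 : Matrix (Fin n) (Fin n) ℂ) ⊗ₖ δ).mulVec x = 0 := by
    ext ⟨i, j⟩
    have hi : ∑ l, x (i, l) * c l = 0 := congrFun hc i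
    rw [one_kronecker_mulVec_apply, Pi.zero_apply, ← mul_zero t, ← hi, Finset.mul_sum]
    exact Finset.sum_congr rfl fun l _ => by rw [hδ]; ring
  have hPx : ((1 : Matrix (Fin n) (Fin n) ℂ) ⊗ₖ (1 - δᴴ * δ)).mulVec x = x := by
    have : (1 : Matrix (Fin n) (Fin n) ℂ) ⊗ₖ (1 - δᴴ * δ) =
        1 - ((1 : Matrix (Fin n) (Fin n) ℂ) ⊗ₖ δᴴ) * ((1 : Matrix (Fin n) (Fin n) ℂ) ⊗ₖ δ) := by
      rw [← Matrix.mul_kronecker_mul, Matrix.mul_one, eq_sub_iff_add_eq, ← Matrix.kronecker_add,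
        sub_add_cancel, Matrix.one_kronecker_one]
    rw [this, Matrix.sub_mulVec, ← Matrix.mulVec_mulVec, hδx, Matrix.mulVec_zero,
      Matrix.one_mulVec, sub_zero]
  have hPδ := proj_compl_convex hδ1
  have main : ∀ w ∈ K 1, (mconj (1 - δᴴ * δ) A).trace + w.trace = A.trace := by
    intro w hw
    have hmem := hK.mconj_add_mconj_mem hn one_pos hn hA hw (1 - δᴴ * δ) δ hPδ
    have hsing : ¬ IsUnit (α ⊗ₖ (1 : Matrix (Fin n) (Fin n) ℂ) -
        reM (amplify (⇑Φ) (mconj (1 - δᴴ * δ) A + mconj δ w))) := by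
      intro hu
      refine hx (Matrix.mulVec_injective_of_isUnit hu ?_)
      have hp := pencil_mconj_add_mconj (Φ : V →ₗ[ℂ] Matrix (Fin n) (Fin n) ℂ) α _ _ hPδ A w
      simp only [ContinuousLinearMap.coe_coe] at hp
      simp only [Matrix.mulVec_zero]
      rw [hp, Matrix.add_mulVec, ← Matrix.mulVec_mulVec, ← Matrix.mulVec_mulVec,
        ← Matrix.mulVec_mulVec, hPx, hδx, hker, Matrix.mulVec_zero, Matrix.mulVec_zero, add_zero]
    obtain ⟨U, hU, hBU⟩ := hexp.2.2.subset ⟨hmem, hexp.2.1 n hn _ hmem, hsing⟩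
    rw [← trace_mconj_of_mul_conjTranspose_eq_one (Matrix.mem_unitaryGroup_iff.mp hU) A, ← hBU,
      Matrix.trace_add, trace_mconj_of_mul_conjTranspose_eq_one hδ1]
  obtain ⟨w, hw, hw0⟩ := hnz
  refine hw0 ?_
  have htr : w.trace = 0 := by
    simpa using add_left_cancel ((main w hw).trans (main 0 h0).symm)
  ext i j
  rw [Subsingleton.elim i 0, Subsingleton.elim j 0]
  simpa [Matrix.trace] using htr

end Helpers

section Statements

variable {E F' : Type*} [AddCommGroup E] [Module ℂ E] [AddCommGroup F'] [Module ℂ F']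
theorem exposing_pair_kernel_structure
    (p : E →ₗ[ℂ] F' →ₗ[ℂ] ℂ)
    (K : ∀ n : ℕ, Set (Matrix (Fin n) (Fin n) (WeakBilin p)))
    (hK : IsMatrixConvex K)
    (h0 : (0 : Matrix (Fin 1) (Fin 1) (WeakBilin p)) ∈ K 1)
    (hnz : ∃ w ∈ K 1, w ≠ 0)
    (n : ℕ) (hn : 0 < n)
    (A : Matrix (Fin n) (Fin n) (WeakBilin p)) (hA : A ∈ K n)
    (Φ : WeakBilin p →L[ℂ] Matrix (Fin n) (Fin n) ℂ) (α : Matrix (Fin n) (Fin n) ℂ)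
    (hexp : IsExposingPair K A Φ α) :
    (∀ x : Fin n × Fin n → ℂ, x ≠ 0 →
      (α ⊗ₖ (1 : Matrix (Fin n) (Fin n) ℂ) - reM (amplify (⇑Φ) A)).mulVec x = 0 →
      LinearIndependent ℂ (fun j : Fin n => fun i : Fin n => x (i, j)) ∧
      Submodule.span ℂ (Set.range fun j : Fin n => fun i : Fin n => x (i, j)) = ⊤) ∧
    Module.finrank ℂ
      ↥(LinearMap.ker
        (α ⊗ₖ (1 : Matrix (Fin n) (Fin n) ℂ) - reM (amplify (⇑Φ) A)).mulVecLin) = 1 := by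
  have inj : ∀ x : Fin n × Fin n → ℂ, x ≠ 0 →
      (α ⊗ₖ (1 : Matrix (Fin n) (Fin n) ℂ) - reM (amplify (⇑Φ) A)).mulVec x = 0 →
      IsUnit (Matrix.of fun i j => x (i, j)) := by
    intro x hx hker
    refine Matrix.mulVec_injective_iff_isUnit.mp ?_
    rw [← Matrix.coe_mulVecLin, ← LinearMap.ker_eq_bot, LinearMap.ker_eq_bot']
    exact fun c hc => hexp.eq_zero_of_mulVec_eq_zero hK h0 hnz hn hA hx hker hc
  refine ⟨fun x hx hker => ?_, ?_⟩
  · have hli : LinearIndependent ℂ (fun j : Fin n => fun i : Fin n => x (i, j)) :=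
      Matrix.linearIndependent_cols_of_isUnit (inj x hx hker)
    exact ⟨hli, hli.span_eq_top_of_card_eq_finrank' (by simp)⟩
  · have hAsing : ¬ IsUnit (α ⊗ₖ (1 : Matrix (Fin n) (Fin n) ℂ) - reM (amplify (⇑Φ) A)) :=
      (hexp.2.2.superset ⟨1, one_mem _, (mconj_one A).symm⟩).2.2
    obtain ⟨x, hx, hkx⟩ : ∃ x, x ≠ 0 ∧
        (α ⊗ₖ (1 : Matrix (Fin n) (Fin n) ℂ) - reM (amplify (⇑Φ) A)).mulVec x = 0 := by
      rw [Matrix.exists_mulVec_eq_zero_iff]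
      simpa [Matrix.isUnit_iff_isUnit_det] using hAsing
    refine finrank_eq_one_iff'.mpr
      ⟨⟨x, hkx⟩, fun h => hx (congrArg Subtype.val h), fun ⟨y, hky⟩ => ?_⟩
    set X : Matrix (Fin n) (Fin n) ℂ := Matrix.of fun i j => x (i, j) with hX
    set Y : Matrix (Fin n) (Fin n) ℂ := Matrix.of fun i j => y (i, j) with hY
    have hXu : IsUnit X.det := X.isUnit_iff_isUnit_det.mp (inj x hx hkx)
    have : Nonempty (Fin n) := ⟨⟨0, hn⟩⟩
    obtain ⟨c, hc⟩ := Module.End.exists_eigenvalue (Matrix.toLin' (X⁻¹ * Y))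
    obtain ⟨v, hv⟩ := hc.exists_hasEigenvector
    have hYv : Y.mulVec v = c • X.mulVec v := by
      have h := congrArg X.mulVec hv.apply_eq_smul
      rwa [Matrix.toLin'_apply, Matrix.mulVec_mulVec, Matrix.mul_nonsing_inv_cancel_left _ _ hXu,
        Matrix.mulVec_smul] at h
    refine ⟨c, Subtype.ext ?_⟩
    change c • x = y
    by_contra hne
    refine hv.2 (hexp.eq_zero_of_mulVec_eq_zero hK h0 hnz hn hA
      (sub_ne_zero.mpr (Ne.symm hne)) ?_ ?_)
    · rw [Matrix.mulVec_sub, Matrix.mulVec_smul, hkx, smul_zero, sub_zero]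
      exact hky
    · have : (Matrix.of fun i j => (y - c • x) (i, j)) = Y - c • X := rfl
      rw [this, Matrix.sub_mulVec, Matrix.smul_mulVec, hYv, sub_self]

end Statements
end

section
/- Let K = (K_n)_{n≥1} be a matrix convex set in V with 0 ∈ K₁ and K₁ containing a nonzero point. Then every matrix exposed point of K is a matrix extreme point of K. -/
open scoped Matrix Kronecker ComplexOrder

noncomputable section

namespace MatrixConvex

variable {V : Type*} [AddCommGroup V] [Module ℂ V]

/-- The linear pencil `α ⊗ I_r - Re Φ_r(B)`. -/
def pencil {n r : ℕ} (α : Matrix (Fin n) (Fin n) ℂ) (Φ : V →ₗ[ℂ] Matrix (Fin n) (Fin n) ℂ)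
    (B : Matrix (Fin r) (Fin r) V) : Matrix (Fin n × Fin r) (Fin n × Fin r) ℂ :=
  α ⊗ₖ (1 : Matrix (Fin r) (Fin r) ℂ) - reM (amplify (⇑Φ) B)

theorem amplify_sum {ι : Type*} (s : Finset ι) {n r : ℕ}
    (Φ : V →ₗ[ℂ] Matrix (Fin n) (Fin n) ℂ) (B : ι → Matrix (Fin r) (Fin r) V) :
    amplify (⇑Φ) (∑ i ∈ s, B i) = ∑ i ∈ s, amplify (⇑Φ) (B i) := by
  ext p q
  simp [amplify, Matrix.sum_apply]

theorem amplify_mconj {n m r : ℕ} (Φ : V →ₗ[ℂ] Matrix (Fin n) (Fin n) ℂ)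
    (γ : Matrix (Fin m) (Fin r) ℂ) (B : Matrix (Fin m) (Fin m) V) :
    amplify (⇑Φ) (mconj γ B) =
      ((1 : Matrix (Fin n) (Fin n) ℂ) ⊗ₖ γ)ᴴ * amplify (⇑Φ) B *
        ((1 : Matrix (Fin n) (Fin n) ℂ) ⊗ₖ γ) := by
  ext ⟨a, i⟩ ⟨b, j⟩
  simp only [amplify, mconj, Matrix.of_apply, map_sum, map_smul, Matrix.sum_apply,
    Matrix.smul_apply, Matrix.mul_apply, Fintype.sum_prod_type, Matrix.conjTranspose_apply,
    Matrix.kroneckerMap_apply, Matrix.one_apply, smul_eq_mul]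
  simp only [ite_mul, one_mul, zero_mul, apply_ite star, star_zero, mul_ite, mul_zero,
    Finset.sum_ite_irrel, Finset.sum_const_zero, Finset.sum_ite_eq',
    Finset.mem_univ, if_true, Finset.sum_mul]
  rw [Finset.sum_comm]
  refine Finset.sum_congr rfl fun l _ => Finset.sum_congr rfl fun k _ => ?_
  ring

theorem reM_sum {ι κ : Type*} (s : Finset ι) (X : ι → Matrix κ κ ℂ) :
    reM (∑ i ∈ s, X i) = ∑ i ∈ s, reM (X i) := by
  simp [reM, Matrix.conjTranspose_sum, Finset.sum_add_distrib, Finset.smul_sum]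

theorem reM_conj {κ l : Type*} [Fintype κ] [Fintype l] (T : Matrix κ l ℂ) (X : Matrix κ κ ℂ) :
    reM (Tᴴ * X * T) = Tᴴ * reM X * T := by
  simp [reM, Matrix.conjTranspose_mul, Matrix.mul_assoc, Matrix.mul_add, Matrix.add_mul]

theorem pencil_sum_mconj {ι : Type*} [Fintype ι] {n r : ℕ} (α : Matrix (Fin n) (Fin n) ℂ)
    (Φ : V →ₗ[ℂ] Matrix (Fin n) (Fin n) ℂ) {ns : ι → ℕ}
    (B : ∀ i, Matrix (Fin (ns i)) (Fin (ns i)) V) (γ : ∀ i, Matrix (Fin (ns i)) (Fin r) ℂ)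
    (hγ : ∑ i, (γ i)ᴴ * γ i = 1) :
    pencil α Φ (∑ i, mconj (γ i) (B i)) =
      ∑ i, ((1 : Matrix (Fin n) (Fin n) ℂ) ⊗ₖ γ i)ᴴ * pencil α Φ (B i) *
        ((1 : Matrix (Fin n) (Fin n) ℂ) ⊗ₖ γ i) := by
  simp only [pencil, Matrix.mul_sub, Matrix.sub_mul, Finset.sum_sub_distrib, amplify_sum,
    amplify_mconj, reM_sum, reM_conj]
  congr 1
  rw [← hγ]
  simp only [Matrix.conjTranspose_kronecker, ← Matrix.mul_kronecker_mul, Matrix.conjTranspose_one,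
    Matrix.one_mul, Matrix.mul_one]
  ext ⟨a, i⟩ ⟨b, j⟩
  simp [Matrix.sum_apply, Finset.mul_sum]

theorem not_isUnit_iff_exists_mulVec_eq_zero {ι : Type*} [Fintype ι] [DecidableEq ι]
    (M : Matrix ι ι ℂ) : ¬ IsUnit M ↔ ∃ x ≠ 0, M *ᵥ x = 0 := by
  rw [Matrix.exists_mulVec_eq_zero_iff, Matrix.isUnit_iff_isUnit_det, isUnit_iff_ne_zero, not_not]

theorem trace_mconj {m r : ℕ} (γ : Matrix (Fin m) (Fin r) ℂ) (hγ : γ * γᴴ = 1)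
    (B : Matrix (Fin m) (Fin m) V) : (mconj γ B).trace = B.trace := by
  simp only [Matrix.trace, mconj, Matrix.diag_apply, Matrix.of_apply]
  rw [Finset.sum_comm]
  refine Finset.sum_congr rfl fun k _ => ?_
  rw [Finset.sum_comm]
  have h (l : Fin m) : ∑ i, (star (γ k i) * γ l i) • B k l
      = (1 : Matrix (Fin m) (Fin m) ℂ) l k • B k l := by
    rw [← hγ, ← Finset.sum_smul, Matrix.mul_apply]
    simp [mul_comm]
  simp only [h]
  simp [Matrix.one_apply]

theorem mconj_mem {K : ∀ n : ℕ, Set (Matrix (Fin n) (Fin n) V)} (hK : IsMatrixConvex K)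
    {m n : ℕ} (hm : 0 < m) (hn : 0 < n) {B : Matrix (Fin m) (Fin m) V} (hB : B ∈ K m)
    (γ : Matrix (Fin m) (Fin n) ℂ) (hγ : γᴴ * γ = 1) : mconj γ B ∈ K n := by
  simpa using hK 1 n one_pos hn (fun _ => m) (fun _ => B) (fun _ => γ) (fun _ => hm)
    (fun _ => hB) (by simpa using hγ)

/-- The inclusion of the first `m` coordinates, as the `m × (m+1)` matrix `(I 0)`. -/
def initMat (m : ℕ) : Matrix (Fin m) (Fin (m + 1)) ℂ :=
  Matrix.of fun k i => if i = k.castSucc then 1 else 0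

/-- The last coordinate, as the `1 × (m+1)` matrix `(0 1)`. -/
def lastMat (m : ℕ) : Matrix (Fin 1) (Fin (m + 1)) ℂ :=
  Matrix.of fun _ i => if i = Fin.last m then 1 else 0

theorem initMat_mul_conjTranspose (m : ℕ) : initMat m * (initMat m)ᴴ = 1 := by
  ext i j
  simp [initMat, Matrix.mul_apply, Matrix.one_apply, apply_ite, eq_comm]

theorem lastMat_mul_conjTranspose (m : ℕ) : lastMat m * (lastMat m)ᴴ = 1 := by
  ext i j
  simp [lastMat, Matrix.mul_apply, Matrix.one_apply, apply_ite, Subsingleton.elim i j]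

theorem lastMat_mul_initMat_conjTranspose (m : ℕ) : lastMat m * (initMat m)ᴴ = 0 := by
  ext i j
  simp [lastMat, initMat, Matrix.mul_apply, apply_ite]

theorem initMat_lastMat_sum (m : ℕ) :
    (initMat m)ᴴ * initMat m + (lastMat m)ᴴ * lastMat m = 1 := by
  ext i j
  refine Fin.lastCases ?_ (fun i => ?_) i <;> refine Fin.lastCases ?_ (fun j => ?_) j <;>
  simp [lastMat, initMat, Matrix.mul_apply, Matrix.one_apply, apply_ite, Fin.castSucc_ne_last,
    (Fin.castSucc_ne_last _).symm, eq_comm]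

theorem exists_singular_succ {K : ∀ n : ℕ, Set (Matrix (Fin n) (Fin n) V)}
    (hK : IsMatrixConvex K) {n m : ℕ} (hm : 0 < m) (α : Matrix (Fin n) (Fin n) ℂ)
    (Φ : V →ₗ[ℂ] Matrix (Fin n) (Fin n) ℂ) {B : Matrix (Fin m) (Fin m) V} (hB : B ∈ K m)
    (hs : ¬ IsUnit (pencil α Φ B)) {w : Matrix (Fin 1) (Fin 1) V} (hw : w ∈ K 1) :
    ∃ C ∈ K (m + 1), ¬ IsUnit (pencil α Φ C) ∧ C.trace = B.trace + w.trace := by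
  let ns : Fin 2 → ℕ := Fin.cons m fun _ => 1
  let A : ∀ i : Fin 2, Matrix (Fin (ns i)) (Fin (ns i)) V :=
    Fin.cons (α := fun i => Matrix (Fin (ns i)) (Fin (ns i)) V) B fun _ => w
  let γ : ∀ i : Fin 2, Matrix (Fin (ns i)) (Fin (m + 1)) ℂ :=
    Fin.cons (α := fun i => Matrix (Fin (ns i)) (Fin (m + 1)) ℂ) (initMat m) fun _ => lastMat m
  have hγ : ∑ i, (γ i)ᴴ * γ i = 1 := by
    rw [Fin.sum_univ_two]
    exact initMat_lastMat_sum m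
  have hmem := hK 2 (m + 1) two_pos m.succ_pos ns A γ
    (by rw [Fin.forall_fin_two]; exact ⟨hm, one_pos⟩)
    (by rw [Fin.forall_fin_two]; exact ⟨hB, hw⟩) hγ
  refine ⟨_, hmem, ?_, ?_⟩
  · rw [pencil_sum_mconj α Φ A γ hγ, Fin.sum_univ_two]
    rw [not_isUnit_iff_exists_mulVec_eq_zero] at hs ⊢
    obtain ⟨x, hx0, hx⟩ := hs
    have h0 : ((1 : Matrix (Fin n) (Fin n) ℂ) ⊗ₖ initMat m) *ᵥ
        (((1 : Matrix (Fin n) (Fin n) ℂ) ⊗ₖ (initMat m)ᴴ) *ᵥ x) = x := by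
      rw [Matrix.mulVec_mulVec, ← Matrix.mul_kronecker_mul, initMat_mul_conjTranspose]
      simp
    have h1 : ((1 : Matrix (Fin n) (Fin n) ℂ) ⊗ₖ lastMat m) *ᵥ
        (((1 : Matrix (Fin n) (Fin n) ℂ) ⊗ₖ (initMat m)ᴴ) *ᵥ x) = 0 := by
      rw [Matrix.mulVec_mulVec, ← Matrix.mul_kronecker_mul, lastMat_mul_initMat_conjTranspose]
      simp
    refine ⟨((1 : Matrix (Fin n) (Fin n) ℂ) ⊗ₖ (initMat m)ᴴ) *ᵥ x, ?_, ?_⟩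
    · rintro h
      rw [h, Matrix.mulVec_zero] at h0
      exact hx0 h0.symm
    · rw [Matrix.add_mulVec, ← Matrix.mulVec_mulVec, ← Matrix.mulVec_mulVec,
        ← Matrix.mulVec_mulVec, ← Matrix.mulVec_mulVec]
      change ((1 : Matrix (Fin n) (Fin n) ℂ) ⊗ₖ initMat m)ᴴ *ᵥ (pencil α Φ B *ᵥ
          (((1 : Matrix (Fin n) (Fin n) ℂ) ⊗ₖ initMat m) *ᵥ _)) +
        ((1 : Matrix (Fin n) (Fin n) ℂ) ⊗ₖ lastMat m)ᴴ *ᵥ (pencil α Φ w *ᵥ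
          (((1 : Matrix (Fin n) (Fin n) ℂ) ⊗ₖ lastMat m) *ᵥ _)) = 0
      rw [h0, h1, hx, Matrix.mulVec_zero, Matrix.mulVec_zero, Matrix.mulVec_zero, add_zero]
  · rw [Fin.sum_univ_two, Matrix.trace_add]
    exact congrArg₂ _ (trace_mconj _ (initMat_mul_conjTranspose m) B)
      (trace_mconj _ (lastMat_mul_conjTranspose m) w)

theorem exists_singular_of_le {K : ∀ n : ℕ, Set (Matrix (Fin n) (Fin n) V)}
    (hK : IsMatrixConvex K) (h0 : (0 : Matrix (Fin 1) (Fin 1) V) ∈ K 1)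
    {n m r : ℕ} (hm : 0 < m) (hmr : m ≤ r) (α : Matrix (Fin n) (Fin n) ℂ)
    (Φ : V →ₗ[ℂ] Matrix (Fin n) (Fin n) ℂ) {B : Matrix (Fin m) (Fin m) V} (hB : B ∈ K m)
    (hs : ¬ IsUnit (pencil α Φ B)) :
    ∃ C ∈ K r, ¬ IsUnit (pencil α Φ C) ∧ C.trace = B.trace := by
  induction r, hmr using Nat.le_induction with
  | base => exact ⟨B, hB, hs, rfl⟩
  | succ r hr ih =>
    obtain ⟨C, hC, hCs, hCt⟩ := ih
    obtain ⟨D, hD, hDs, hDt⟩ := exists_singular_succ hK (hm.trans_le hr) α Φ hC hCs h0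
    exact ⟨D, hD, hDs, by simp [hDt, hCt]⟩

/-- A pencil whose singular points at level `n` all have the same trace has no singular points
below level `n`. -/
theorem isUnit_pencil_of_lt {K : ∀ n : ℕ, Set (Matrix (Fin n) (Fin n) V)}
    (hK : IsMatrixConvex K) (h0 : (0 : Matrix (Fin 1) (Fin 1) V) ∈ K 1)
    (hnz : ∃ w ∈ K 1, w ≠ 0) {n : ℕ} {α : Matrix (Fin n) (Fin n) ℂ}
    {Φ : V →ₗ[ℂ] Matrix (Fin n) (Fin n) ℂ} {t : V}
    (ht : ∀ C ∈ K n, ¬ IsUnit (pencil α Φ C) → C.trace = t)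
    {m : ℕ} (hm : 0 < m) (hmn : m < n) {B : Matrix (Fin m) (Fin m) V} (hB : B ∈ K m) :
    IsUnit (pencil α Φ B) := by
  by_contra hs
  obtain ⟨w, hw, hw0⟩ := hnz
  have key (v : Matrix (Fin 1) (Fin 1) V) (hv : v ∈ K 1) : B.trace + v.trace = t := by
    obtain ⟨C, hC, hCs, hCt⟩ := exists_singular_succ hK hm α Φ hB hs hv
    obtain ⟨D, hD, hDs, hDt⟩ := exists_singular_of_le hK h0 m.succ_pos hmn α Φ hC hCs
    rw [← hCt, ← hDt, ht D hD hDs]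
  have h := (key w hw).trans (key 0 h0).symm
  apply hw0
  ext i j
  simpa [Matrix.trace, Subsingleton.elim i 0, Subsingleton.elim j 0] using h

/-- Every subspace of `ℂⁿ` is the range of an isometry. -/
theorem exists_isometry_of_submodule {n : ℕ} (S : Submodule ℂ (EuclideanSpace ℂ (Fin n))) :
    ∃ β : Matrix (Fin n) (Fin (Module.finrank ℂ S)) ℂ, βᴴ * β = 1 ∧
      ∀ v ∈ S, (β * βᴴ) *ᵥ v.ofLp = v.ofLp := by
  let b := stdOrthonormalBasis ℂ S
  refine ⟨Matrix.of fun i k => (b k : EuclideanSpace ℂ (Fin n)) i, ?_, fun v hv => ?_⟩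
  · ext k l
    have h := orthonormal_iff_ite.mp b.orthonormal k l
    rw [Submodule.coe_inner, PiLp.inner_apply] at h
    simpa [Matrix.mul_apply, Matrix.one_apply, mul_comm] using h
  · have h := congrArg (fun u : S => (u : EuclideanSpace ℂ (Fin n)).ofLp) (b.sum_repr' ⟨v, hv⟩)
    simp only [Submodule.coe_inner, PiLp.inner_apply, Submodule.coe_sum, Submodule.coe_smul] at h
    rw [← Matrix.mulVec_mulVec]
    ext i
    rw [← congrFun h i]
    simp [Matrix.mulVec, dotProduct, mul_comm]

/-- If the pencil is nonsingular at all levels below `n`, a kernel vector at level `n` is not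
annihilated by `I ⊗ γ` for any nonzero `γ`. -/
theorem kronecker_mulVec_ne_zero {K : ∀ n : ℕ, Set (Matrix (Fin n) (Fin n) V)}
    (hK : IsMatrixConvex K) {n : ℕ} {α : Matrix (Fin n) (Fin n) ℂ}
    {Φ : V →ₗ[ℂ] Matrix (Fin n) (Fin n) ℂ}
    (hreg : ∀ m, 0 < m → m < n → ∀ B ∈ K m, IsUnit (pencil α Φ B))
    (hn : 0 < n) {A : Matrix (Fin n) (Fin n) V} (hA : A ∈ K n) {x : Fin n × Fin n → ℂ}
    (hx0 : x ≠ 0) (hx : pencil α Φ A *ᵥ x = 0) {m : ℕ} {γ : Matrix (Fin m) (Fin n) ℂ}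
    (hγ : γ ≠ 0) : ((1 : Matrix (Fin n) (Fin n) ℂ) ⊗ₖ γ) *ᵥ x ≠ 0 := by
  intro hz
  let S : Submodule ℂ (EuclideanSpace ℂ (Fin n)) := LinearMap.ker (Matrix.toEuclideanLin γ)
  obtain ⟨β, hβ, hβS⟩ := exists_isometry_of_submodule S
  have hxS (a : Fin n) : (WithLp.toLp 2 fun i => x (a, i)) ∈ S := by
    rw [LinearMap.mem_ker]
    ext k
    simpa [Matrix.toLpLin_apply, Matrix.mulVec, dotProduct, Fintype.sum_prod_type,
      Matrix.one_apply] using congrFun hz (a, k)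
  have hlt : Module.finrank ℂ S < n := by
    have hS : S ≠ ⊤ := by
      intro h
      apply hγ
      have := LinearMap.ker_eq_top.mp h
      simpa using this
    simpa using Submodule.finrank_lt hS
  have hpos : 0 < Module.finrank ℂ S := by
    rw [Module.finrank_pos_iff, Submodule.nontrivial_iff_ne_bot]
    rintro h
    apply hx0
    ext ⟨a, i⟩
    have h2 := hxS a
    rw [h, Submodule.mem_bot] at h2
    exact congrFun (congrArg WithLp.ofLp h2) i
  have hβx : ((1 : Matrix (Fin n) (Fin n) ℂ) ⊗ₖ β) *ᵥ
      (((1 : Matrix (Fin n) (Fin n) ℂ) ⊗ₖ βᴴ) *ᵥ x) = x := by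
    rw [Matrix.mulVec_mulVec, ← Matrix.mul_kronecker_mul, Matrix.mul_one]
    ext ⟨a, i⟩
    have h := congrFun (hβS _ (hxS a)) i
    simpa [Matrix.mulVec, dotProduct, Fintype.sum_prod_type, Matrix.one_apply] using h
  refine absurd (hreg _ hpos hlt _ (mconj_mem hK hn hpos hA β hβ)) ?_
  rw [not_isUnit_iff_exists_mulVec_eq_zero]
  refine ⟨((1 : Matrix (Fin n) (Fin n) ℂ) ⊗ₖ βᴴ) *ᵥ x, fun h => ?_, ?_⟩
  · rw [h, Matrix.mulVec_zero] at hβx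
    exact hx0 hβx.symm
  · have h := pencil_sum_mconj (ι := Unit) α Φ (fun _ => A) (fun _ => β) (by simpa using hβ)
    simp only [Finset.univ_unique, Finset.sum_singleton] at h
    rw [h, ← Matrix.mulVec_mulVec, ← Matrix.mulVec_mulVec, hβx, hx, Matrix.mulVec_zero]

theorem mulVec_mulVec_eq_zero_of_sum {ι κ : Type*} [Fintype ι] [Fintype κ] {l : ι → Type*}
    [∀ i, Fintype (l i)] (P : ∀ i, Matrix (l i) (l i) ℂ) (hP : ∀ i, (P i).PosSemidef)
    (T : ∀ i, Matrix (l i) κ ℂ) {x : κ → ℂ} (hx : (∑ i, (T i)ᴴ * P i * T i) *ᵥ x = 0) (i : ι) :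
    P i *ᵥ (T i *ᵥ x) = 0 := by
  have h : ∑ i, star (T i *ᵥ x) ⬝ᵥ (P i *ᵥ (T i *ᵥ x)) = 0 := by
    have h := congrArg (star x ⬝ᵥ ·) hx
    simpa only [Matrix.sum_mulVec, dotProduct_sum, dotProduct_zero, Matrix.mul_assoc,
      ← Matrix.mulVec_mulVec, Matrix.dotProduct_mulVec _ (T _)ᴴ, ← Matrix.star_mulVec] using h
  rw [Finset.sum_eq_zero_iff_of_nonneg fun i _ => (hP i).dotProduct_mulVec_nonneg _] at h
  exact ((hP i).dotProduct_mulVec_zero_iff _).mp (h i (Finset.mem_univ i))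

end MatrixConvex

end

section Statements

variable {E F' : Type*} [AddCommGroup E] [Module ℂ E] [AddCommGroup F'] [Module ℂ F']
theorem matrixExposed_isMatrixExtreme
    (p : E →ₗ[ℂ] F' →ₗ[ℂ] ℂ)
    (K : ∀ n : ℕ, Set (Matrix (Fin n) (Fin n) (WeakBilin p)))
    (hK : IsMatrixConvex K)
    (h0 : (0 : Matrix (Fin 1) (Fin 1) (WeakBilin p)) ∈ K 1)
    (hnz : ∃ w ∈ K 1, w ≠ 0)
    (n : ℕ) (hn : 0 < n)
    (A : Matrix (Fin n) (Fin n) (WeakBilin p)) (hA : A ∈ K n)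
    (hAe : IsMatrixExposed K A) :
    IsMatrixExtreme K A := by
  obtain ⟨Φ, α, -, hpos, hset⟩ := hAe
  have horbit (C : Matrix (Fin n) (Fin n) (WeakBilin p)) (hC : C ∈ K n)
      (hs : ¬ IsUnit (MatrixConvex.pencil α Φ.toLinearMap C)) :
      ∃ U ∈ Matrix.unitaryGroup (Fin n) ℂ, C = mconj U A :=
    hset.subset ⟨hC, hpos n hn C hC, hs⟩
  have hsing : ¬ IsUnit (MatrixConvex.pencil α Φ.toLinearMap A) := by
    have hA1 : A = mconj 1 A := by
      ext i j
      simp [mconj, Matrix.one_apply]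
    exact (hset.superset ⟨1, one_mem _, hA1⟩).2.2
  have hreg : ∀ m, 0 < m → m < n → ∀ B ∈ K m,
      IsUnit (MatrixConvex.pencil α Φ.toLinearMap B) := by
    intro m hm hmn B hB
    refine MatrixConvex.isUnit_pencil_of_lt hK h0 hnz (t := A.trace) (fun C hC hs => ?_) hm hmn hB
    obtain ⟨U, hU, rfl⟩ := horbit C hC hs
    exact MatrixConvex.trace_mconj U (Matrix.mem_unitaryGroup_iff.mp hU) A
  refine ⟨hA, fun k _ ns Ai γ hns hAi hsurj hsum hcomb i => ?_⟩
  obtain ⟨x, hx0, hx⟩ := (MatrixConvex.not_isUnit_iff_exists_mulVec_eq_zero _).mp hsing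
  have hγ : γ i ≠ 0 := by
    intro h
    obtain ⟨v, hv⟩ := hsurj i 1
    rw [h, Matrix.zero_mulVec] at hv
    exact zero_ne_one (congrFun hv ⟨0, hns i⟩)
  have hne := MatrixConvex.kronecker_mulVec_ne_zero hK hreg hn hA hx0 hx hγ
  have hker := hx
  rw [← hcomb, MatrixConvex.pencil_sum_mconj α Φ.toLinearMap Ai γ hsum] at hker
  have hi := MatrixConvex.mulVec_mulVec_eq_zero_of_sum _ (fun i => hpos _ (hns i) _ (hAi i))
    _ hker i
  have hsi : ¬ IsUnit (MatrixConvex.pencil α Φ.toLinearMap (Ai i)) :=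
    (MatrixConvex.not_isUnit_iff_exists_mulVec_eq_zero _).mpr ⟨_, hne, hi⟩
  have hle : ns i ≤ n := by
    simpa using LinearMap.finrank_le_finrank_of_surjective (f := (γ i).mulVecLin) (hsurj i)
  have hni : ns i = n :=
    hle.eq_of_not_lt fun hlt => hsi (hreg _ (hns i) hlt _ (hAi i))
  refine ⟨hni, ?_⟩
  have hAii := hAi i
  generalize Ai i = B at hAii hsi
  generalize hm : ns i = m at B hni
  subst hni
  simpa using horbit B hAii hsi

end Statements
end
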